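/- arXiv:2509.09981 — 4 statements merged into one kernel-verified Lean document; each statement's English description precedes it below -/
import Mathlib

section
/- Let T ⊆ ℝ² be a triangle with positive area (the convex hull of three affinely independent points), let p and q be two distinct points lying in the relative interiors of edges of T, and let u and v be two linearly independent vectors in ℝ². Then there exists an injective continuous path γ : [0,1] → T with γ(0) = p and γ(1) = q whose image is a finite union of line segments, each of which is parallel to u or parallel to v. -/
open Set Topology

variable {E : Type*} [NormedAddCommGroup E] [NormedSpace ℝ E]

/-- The vector `w` is a multiple of `u` or of `v`. -/
def IsAlong (u v w : E) : Prop := (∃ c : ℝ, w = c • u) ∨ ∃ c : ℝ, w = c • v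

lemma IsAlong.smul {u v w : E} (h : IsAlong u v w) (t : ℝ) : IsAlong u v (t • w) := by
  rcases h with ⟨c, rfl⟩ | ⟨c, rfl⟩
  · exact Or.inl ⟨t * c, smul_smul _ _ _⟩
  · exact Or.inr ⟨t * c, smul_smul _ _ _⟩

/-- `PolyArc u v x y K`: the set `K` is traced by a simple polygonal path from `x` to `y` whose
segments are parallel to `u` or `v`. -/
inductive PolyArc (u v x : E) : E → Set E → Prop
  | nil : PolyArc u v x x {x}
  | snoc {y z : E} {K : Set E} : PolyArc u v x y K → y ≠ z → IsAlong u v (z - y) →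
      K ∩ segment ℝ y z ⊆ {y} → PolyArc u v x z (K ∪ segment ℝ y z)

namespace PolyArc

variable {u v x y z w : E} {K S : Set E}

lemma right_mem (h : PolyArc u v x y K) : y ∈ K := by
  cases h with
  | nil => rfl
  | snoc => exact Or.inr (right_mem_segment ℝ _ _)

lemma isCompact (h : PolyArc u v x y K) : IsCompact K := by
  induction h with
  | nil => exact isCompact_singleton
  | snoc _ _ _ _ ih =>
    refine ih.union ?_
    rw [segment_eq_image_lineMap]
    exact isCompact_Icc.image AffineMap.lineMap_continuous

lemma exists_truncation (h : PolyArc u v x y K) (hw : w ∈ K) :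
    ∃ K' ⊆ K, PolyArc u v x w K' := by
  induction h with
  | nil => obtain rfl := hw; exact ⟨_, Subset.rfl, nil⟩
  | @snoc y z K h hyz hd hK ih =>
    by_cases hwK : w ∈ K
    · obtain ⟨K', hK', h'⟩ := ih hwK
      exact ⟨K', hK'.trans subset_union_left, h'⟩
    · have hws : w ∈ segment ℝ y z := hw.resolve_left hwK
      have hsub : segment ℝ y w ⊆ segment ℝ y z :=
        (convex_segment y z).segment_subset (left_mem_segment ℝ y z) hws
      refine ⟨K ∪ segment ℝ y w, union_subset_union_right K hsub, h.snoc ?_ ?_ ?_⟩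
      · rintro rfl
        exact hwK h.right_mem
      · rw [segment_eq_image'] at hws
        obtain ⟨t, -, rfl⟩ := hws
        simpa using hd.smul t
      · exact (inter_subset_inter_right K hsub).trans hK

/-- Loop erasure: a simple path can be prolonged by a segment, after shortening it if needed. -/
lemma exists_extension (h : PolyArc u v x y K) (hKS : K ⊆ S) (hS : Convex ℝ S) (hz : z ∈ S)
    (hd : IsAlong u v (z - y)) : ∃ K' ⊆ S, PolyArc u v x z K' := by
  have hcont : Continuous fun t : ℝ => z + t • (y - z) := by fun_prop
  have hcomp : IsCompact (Icc (0 : ℝ) 1 ∩ (fun t : ℝ => z + t • (y - z)) ⁻¹' K) :=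
    isCompact_Icc.inter_right (h.isCompact.isClosed.preimage hcont)
  obtain ⟨t, ⟨ht, htK⟩, hmin⟩ := hcomp.exists_isLeast
    ⟨1, ⟨zero_le_one, le_rfl⟩, by simpa using h.right_mem⟩
  obtain ⟨K', hK', h'⟩ := h.exists_truncation htK
  rcases ht.1.eq_or_lt with rfl | ht0
  · exact ⟨K', hK'.trans hKS, by simpa using h'⟩
  by_cases hyz : y = z
  · subst hyz
    exact ⟨K, hKS, h⟩
  refine ⟨_, union_subset (hK'.trans hKS) (hS.segment_subset (hKS htK) hz), h'.snoc ?_ ?_ ?_⟩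
  · simp [ht0.ne', sub_eq_zero, hyz]
  · have : z - (z + t • (y - z)) = t • (z - y) := by module
    simpa only [this] using hd.smul t
  · rintro a ⟨haK, ha⟩
    rw [segment_symm, segment_eq_image'] at ha
    obtain ⟨s, hs, rfl⟩ := ha
    have heq : z + s • (z + t • (y - z) - z) = z + (s * t) • (y - z) := by module
    simp only [heq] at haK ⊢
    have hle : t ≤ s * t :=
      hmin ⟨⟨mul_nonneg hs.1 ht.1, mul_le_one₀ hs.2 ht.1 ht.2⟩, hK' haK⟩
    rw [le_antisymm (mul_le_of_le_one_left ht.1 hs.2) hle]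
    rfl

lemma exists_finite_segments (h : PolyArc u v x y K) :
    ∃ F : Set (E × E), F.Finite ∧ K = ⋃ e ∈ F, segment ℝ e.1 e.2 ∧
      ∀ e ∈ F, IsAlong u v (e.2 - e.1) := by
  induction h with
  | nil =>
    refine ⟨{(x, x)}, finite_singleton _, by simp, ?_⟩
    rintro _ rfl
    exact Or.inl ⟨0, by simp⟩
  | @snoc y z K _ _ hd _ ih =>
    obtain ⟨F, hF, hK, hFd⟩ := ih
    refine ⟨insert (y, z) F, hF.insert _, ?_, ?_⟩
    · rw [biUnion_insert, union_comm, hK]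
    · rintro e (rfl | he)
      exacts [hd, hFd e he]

lemma exists_parametrization_nat (h : PolyArc u v x y K) :
    ∃ (n : ℕ) (γ : ℝ → E), ContinuousOn γ (Icc 0 n) ∧ InjOn γ (Icc 0 n) ∧
      γ '' Icc 0 n = K ∧ γ 0 = x ∧ γ n = y := by
  induction h with
  | nil => exact ⟨0, fun _ => x, by simp⟩
  | @snoc y z K _ hyz _ hK ih =>
    obtain ⟨n, γ, hc, hi, him, h0, hn⟩ := ih
    have hn0 : (0 : ℝ) ≤ n := n.cast_nonneg
    set δ : ℝ → E := fun t => γ (min t n) + max (t - n) 0 • (z - y) with hδ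
    have hδl : ∀ t ≤ (n : ℝ), δ t = γ t := fun t ht => by
      simp [hδ, ht]
    have hδr : ∀ t, (n : ℝ) ≤ t → δ t = y + (t - n) • (z - y) := fun t ht => by
      simp [hδ, ht, hn]
    have hmem : ∀ t ∈ Icc (0 : ℝ) n, γ t ∈ K := fun t ht => him ▸ mem_image_of_mem γ ht
    have hseg : ∀ t ∈ Icc (n : ℝ) (n + 1), y + (t - n) • (z - y) ∈ segment ℝ y z := by
      intro t ht
      rw [segment_eq_image']
      exact ⟨t - n, ⟨by linarith [ht.1], by linarith [ht.2]⟩, rfl⟩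
    have hcross : ∀ s ∈ Icc (0 : ℝ) n, ∀ t ∈ Icc (n : ℝ) (n + 1), δ s = δ t → s = t := by
      intro s hs t ht hst
      rw [hδl s hs.2, hδr t ht.1] at hst
      have hy : γ s = y := hK ⟨hmem s hs, hst ▸ hseg t ht⟩
      have hsn : s = n := hi hs ⟨hn0, le_rfl⟩ (hy.trans hn.symm)
      rw [hy, left_eq_add, smul_eq_zero, sub_eq_zero, sub_eq_zero] at hst
      rw [hsn, hst.resolve_right hyz.symm]
    have hIcc : Icc (0 : ℝ) (n + 1) = Icc 0 (n : ℝ) ∪ Icc (n : ℝ) (n + 1) :=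
      (Icc_union_Icc_eq_Icc hn0 (by linarith)).symm
    refine ⟨n + 1, δ, ?_, ?_, ?_, ?_, ?_⟩
    · refine ContinuousOn.add (hc.comp (by fun_prop) fun t ht => ?_) (by fun_prop)
      exact ⟨le_min ht.1 hn0, min_le_right _ _⟩
    · push_cast
      rw [hIcc]
      rintro s (hs | hs) t (ht | ht) hst
      · rw [hδl s hs.2, hδl t ht.2] at hst
        exact hi hs ht hst
      · exact hcross s hs t ht hst
      · exact (hcross t ht s hs hst.symm).symm
      · rw [hδr s hs.1, hδr t ht.1, add_right_inj] at hst
        have := smul_left_injective ℝ (sub_ne_zero.2 hyz.symm) hst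
        linarith
    · push_cast
      rw [hIcc, image_union]
      congr 1
      · rw [← him]
        exact image_congr fun t ht => hδl t ht.2
      · rw [image_congr fun t ht => hδr t ht.1, segment_eq_image']
        refine Subset.antisymm ?_ ?_
        · rintro _ ⟨t, ht, rfl⟩
          exact ⟨t - n, ⟨by linarith [ht.1], by linarith [ht.2]⟩, rfl⟩
        · rintro _ ⟨t, ht, rfl⟩
          exact ⟨t + n, ⟨by linarith [ht.1], by linarith [ht.2]⟩, by simp⟩
    · rw [hδl 0 hn0, h0]
    · push_cast
      rw [hδr _ (by linarith)]
      simp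

lemma exists_parametrization (h : PolyArc u v x y K) (hxy : x ≠ y) :
    ∃ γ : ℝ → E, ContinuousOn γ (Icc 0 1) ∧ InjOn γ (Icc 0 1) ∧
      γ '' Icc 0 1 = K ∧ γ 0 = x ∧ γ 1 = y := by
  obtain ⟨n, γ, hc, hi, him, h0, hn⟩ := h.exists_parametrization_nat
  have hpos : (0 : ℝ) < n := by
    rcases n.eq_zero_or_pos with rfl | hn'
    · exact absurd (h0.symm.trans (by simpa using hn)) hxy
    · exact_mod_cast hn'
  have himg : (fun t : ℝ => (n : ℝ) * t) '' Icc 0 1 = Icc 0 (n : ℝ) := by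
    rw [image_mul_left_Icc hpos.le zero_le_one]
    simp
  have hmaps : MapsTo (fun t : ℝ => (n : ℝ) * t) (Icc 0 1) (Icc 0 (n : ℝ)) :=
    himg ▸ mapsTo_image _ _
  refine ⟨γ ∘ fun t => n * t, hc.comp (by fun_prop) hmaps,
    hi.comp (mul_right_injective₀ hpos.ne').injOn hmaps, ?_, by simpa, by simpa⟩
  rw [image_comp, himg, him]

end PolyArc

/-- `x` and `y` are points of `S` on a common line of direction `u` or `v`. -/
def AlongStep (u v : E) (S : Set E) (x y : E) : Prop :=
  x ∈ S ∧ y ∈ S ∧ IsAlong u v (y - x)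

lemma AlongStep.symm {u v : E} {S : Set E} {x y : E} (h : AlongStep u v S x y) :
    AlongStep u v S y x :=
  ⟨h.2.1, h.1, by simpa using h.2.2.smul (-1)⟩

lemma reflTransGen_alongStep_symm {u v : E} {S : Set E} {x y : E}
    (h : Relation.ReflTransGen (AlongStep u v S) x y) :
    Relation.ReflTransGen (AlongStep u v S) y x := by
  induction h with
  | refl => exact .refl
  | tail _ h ih => exact .head h.symm ih

lemma exists_polyArc {u v : E} {S : Set E} (hS : Convex ℝ S) {x y : E} (hx : x ∈ S)
    (h : Relation.ReflTransGen (AlongStep u v S) x y) : ∃ K ⊆ S, PolyArc u v x y K := by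
  induction h with
  | refl => exact ⟨{x}, by simpa, .nil⟩
  | tail _ h ih =>
    obtain ⟨K, hK, hA⟩ := ih
    exact hA.exists_extension hK hS h.2.1 h.2.2

/-- Any two interior points of a convex set in the plane are joined by steps along `u` and `v`. -/
lemma reflTransGen_alongStep_of_mem_interior {S : Set E} (hS : Convex ℝ S)
    (b : Module.Basis (Fin 2) ℝ E) {x y : E} (hx : x ∈ interior S) (hy : y ∈ interior S) :
    Relation.ReflTransGen (AlongStep (b 0) (b 1) S) x y := by
  have : FiniteDimensional ℝ E := b.finiteDimensional_of_finite
  refine hS.interior.isPreconnected.induction₂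
    (Relation.ReflTransGen (AlongStep (b 0) (b 1) S)) (fun x hx => ?_)
    (fun _ _ _ _ _ _ h h' => h.trans h')
    (fun _ _ _ _ h => reflTransGen_alongStep_symm h) hx hy
  have hcoord : Continuous fun z : E => b.repr (z - x) 0 :=
    ((b.coord 0).continuous_of_finiteDimensional).comp (continuous_id.sub continuous_const)
  have hmid : ContinuousAt (fun z : E => x + b.repr (z - x) 0 • b 0) x :=
    (continuous_const.add (hcoord.smul continuous_const)).continuousAt
  have hnear : ∀ᶠ z in 𝓝 x, x + b.repr (z - x) 0 • b 0 ∈ interior S :=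
    hmid.eventually_mem (isOpen_interior.mem_nhds (by simpa using hx))
  filter_upwards [self_mem_nhdsWithin, nhdsWithin_le_nhds hnear] with z hz hm
  have hxS := interior_subset hx
  have hmS := interior_subset hm
  have hzS := interior_subset hz
  have hsum := b.sum_repr (z - x)
  rw [Fin.sum_univ_two] at hsum
  refine .tail (.single ⟨hxS, hmS, Or.inl ⟨_, add_sub_cancel_left _ _⟩⟩)
    ⟨hmS, hzS, Or.inr ⟨b.repr (z - x) 1, ?_⟩⟩
  rw [← sub_sub]
  exact sub_eq_of_eq_add' hsum.symm

/-- From a point in the relative interior of a facet one can step into the interior of a simplex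
along one of any two vectors spanning the space. -/
lemma exists_alongStep_interior {ι : Type*} [Fintype ι] [Nontrivial ι] (B : AffineBasis ι ℝ E)
    (b : Module.Basis (Fin 2) ℝ E)
    {p : E} {k : ι} (hk : B.coord k p = 0) (hpos : ∀ j ≠ k, 0 < B.coord j p) :
    ∃ p' ∈ interior (convexHull ℝ (range B)),
      AlongStep (b 0) (b 1) (convexHull ℝ (range B)) p p' := by
  have : FiniteDimensional ℝ E := b.finiteDimensional_of_finite
  have hstep : ∀ w : E, (B.coord k).linear w ≠ 0 →
      ∃ c : ℝ, p + c • w ∈ interior (convexHull ℝ (range B)) := by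
    intro w hw
    set l := (B.coord k).linear w with hl
    have hadd : ∀ (j : ι) (c : ℝ),
        B.coord j (p + c • l • w) = c * (l * (B.coord j).linear w) + B.coord j p := by
      intro j c
      rw [add_comm p, ← vadd_eq_add, AffineMap.map_vadd, map_smul, map_smul]
      rfl
    have hev : ∀ᶠ c in 𝓝[>] (0 : ℝ), ∀ j, 0 < B.coord j (p + c • l • w) := by
      rw [Filter.eventually_all]
      intro j
      simp only [hadd]
      by_cases hj : j = k
      · subst hj
        filter_upwards [self_mem_nhdsWithin] with c hc
        rw [hk, ← hl, add_zero]
        exact mul_pos hc (mul_self_pos.2 hw)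
      · have hcont :
            ContinuousAt (fun c : ℝ => c * (l * (B.coord j).linear w) + B.coord j p) 0 := by
          fun_prop
        exact nhdsWithin_le_nhds (hcont.eventually (lt_mem_nhds (by simpa using hpos j hj)))
    obtain ⟨c, hc⟩ := hev.exists
    refine ⟨c * l, ?_⟩
    rw [B.interior_convexHull, mul_smul]
    exact hc
  have hp : p ∈ convexHull ℝ (range B) := by
    rw [B.convexHull_eq_nonneg_coord]
    intro j
    by_cases hj : j = k
    · exact (hj ▸ hk).ge
    · exact (hpos j hj).le
  by_cases h0 : (B.coord k).linear (b 0) = 0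
  · by_cases h1 : (B.coord k).linear (b 1) = 0
    · obtain ⟨j, hj⟩ := exists_ne k
      have hlin : (B.coord k).linear = 0 := b.ext (Fin.forall_fin_two.2 ⟨h0, h1⟩)
      have := (B.coord k).linearMap_vsub (B k) (B j)
      rw [hlin, vsub_eq_sub (B.coord k (B k)), B.coord_apply_eq, B.coord_apply_ne hj.symm] at this
      simp at this
    · obtain ⟨c, hc⟩ := hstep _ h1
      exact ⟨_, hc, hp, interior_subset hc, Or.inr ⟨c, add_sub_cancel_left _ _⟩⟩
  · obtain ⟨c, hc⟩ := hstep _ h0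
    exact ⟨_, hc, hp, interior_subset hc, Or.inl ⟨c, add_sub_cancel_left _ _⟩⟩

lemma AffineBasis.coord_of_mem_openSegment (B : AffineBasis (Fin 3) ℝ E) {i j k : Fin 3} {p : E}
    (hij : i ≠ j) (hki : k ≠ i) (hkj : k ≠ j) (hp : p ∈ openSegment ℝ (B i) (B j)) :
    B.coord k p = 0 ∧ ∀ l ≠ k, 0 < B.coord l p := by
  rw [openSegment_eq_image_lineMap] at hp
  obtain ⟨t, ht, rfl⟩ := hp
  have hcoord : ∀ l, B.coord l (AffineMap.lineMap (B i) (B j) t) =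
      (1 - t) * B.coord l (B i) + t * B.coord l (B j) := by
    intro l
    rw [AffineMap.apply_lineMap, AffineMap.lineMap_apply_ring]
  have hl : ∀ l ≠ k, l = i ∨ l = j := by lia
  refine ⟨by simp [hcoord, B.coord_apply, hki, hkj], fun l hlk => ?_⟩
  rcases hl l hlk with rfl | rfl
  · simpa [hcoord, B.coord_apply, hij] using ht.2
  · simpa [hcoord, B.coord_apply, hij.symm] using ht.1


open scoped RealInnerProductSpace

/-- In a triangle `T` with positive area, any two distinct points `p, q` in the relative
interiors of edges of `T` can be joined by an injective path inside `T` whose image is a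
finite union of line segments, each parallel to one of two given linearly independent
vectors `u, v`. -/
theorem stmt_8 (A B C : EuclideanSpace ℝ (Fin 2)) (hABC : AffineIndependent ℝ ![A, B, C])
    (T : Set (EuclideanSpace ℝ (Fin 2))) (hT : T = convexHull ℝ {A, B, C})
    (p q : EuclideanSpace ℝ (Fin 2)) (hpq : p ≠ q)
    (hp : p ∈ openSegment ℝ A B ∪ openSegment ℝ B C ∪ openSegment ℝ C A)
    (hq : q ∈ openSegment ℝ A B ∪ openSegment ℝ B C ∪ openSegment ℝ C A)
    (u v : EuclideanSpace ℝ (Fin 2)) (huv : LinearIndependent ℝ ![u, v]) :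
    ∃ γ : ℝ → EuclideanSpace ℝ (Fin 2),
      ContinuousOn γ (Set.Icc 0 1) ∧ Set.InjOn γ (Set.Icc 0 1) ∧
      γ '' Set.Icc 0 1 ⊆ T ∧ γ 0 = p ∧ γ 1 = q ∧
      ∃ (n : ℕ) (a b : Fin n → EuclideanSpace ℝ (Fin 2)),
        γ '' Set.Icc 0 1 = ⋃ i, segment ℝ (a i) (b i) ∧
        ∀ i, (∃ c : ℝ, b i - a i = c • u) ∨ (∃ c : ℝ, b i - a i = c • v) := by
  have hdim : Module.finrank ℝ (EuclideanSpace ℝ (Fin 2)) = 2 := finrank_euclideanSpace_fin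
  let b : Module.Basis (Fin 2) ℝ (EuclideanSpace ℝ (Fin 2)) :=
    basisOfLinearIndependentOfCardEqFinrank huv (by simp)
  have hb0 : b 0 = u := by simp [b]
  have hb1 : b 1 = v := by simp [b]
  let Δ : AffineBasis (Fin 3) ℝ (EuclideanSpace ℝ (Fin 2)) :=
    ⟨![A, B, C], hABC, by
      rw [hABC.affineSpan_eq_top_iff_card_eq_finrank_add_one]; simp⟩
  have hTΔ : T = convexHull ℝ (range Δ) := by
    have : range Δ = {A, B, C} := by
      change range ![A, B, C] = _
      rw [Matrix.range_cons, Matrix.range_cons_cons_empty]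
      rfl
    rw [hT, this]
  have hfacet : ∀ r ∈ openSegment ℝ A B ∪ openSegment ℝ B C ∪ openSegment ℝ C A,
      ∃ r' ∈ interior T, AlongStep u v T r r' := by
    intro r hr
    obtain ⟨k, hk, hpos⟩ : ∃ k, Δ.coord k r = 0 ∧ ∀ j ≠ k, 0 < Δ.coord j r := by
      rcases hr with (hr | hr) | hr
      · exact ⟨2, Δ.coord_of_mem_openSegment (i := 0) (j := 1) (by decide) (by decide)
          (by decide) hr⟩
      · exact ⟨0, Δ.coord_of_mem_openSegment (i := 1) (j := 2) (by decide) (by decide)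
          (by decide) hr⟩
      · exact ⟨1, Δ.coord_of_mem_openSegment (i := 2) (j := 0) (by decide) (by decide)
          (by decide) hr⟩
    simpa only [hTΔ, hb0, hb1] using exists_alongStep_interior Δ b hk hpos
  have hconv : Convex ℝ T := hT ▸ convex_convexHull ℝ _
  obtain ⟨p', hp', hpp'⟩ := hfacet p hp
  obtain ⟨q', hq', hqq'⟩ := hfacet q hq
  have hmid := reflTransGen_alongStep_of_mem_interior hconv b hp' hq'
  rw [hb0, hb1] at hmid
  obtain ⟨K, hKT, hK⟩ := exists_polyArc hconv hpp'.1 ((hmid.head hpp').tail hqq'.symm)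
  obtain ⟨γ, hc, hi, him, h0, h1⟩ := hK.exists_parametrization hpq
  obtain ⟨F, hF, hKF, hFd⟩ := hK.exists_finite_segments
  obtain ⟨n, e, -, rfl⟩ := hF.fin_param
  exact ⟨γ, hc, hi, him ▸ hKT, h0, h1, n, fun i => (e i).1, fun i => (e i).2,
    by rw [him, hKF, biUnion_range], fun i => hFd _ (mem_range_self i)⟩
end

section
/- Let T ⊆ ℝ² be a triangle with positive area and let p and q be two distinct points lying in the relative interiors of edges of T. Then there exists an injective continuous path γ : [0,1] → T with γ(0) = p and γ(1) = q whose image is a finite union of axis-parallel line segments (each segment horizontal, i.e., parallel to (1,0), or vertical, i.e., parallel to (0,1)). -/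
open scoped RealInnerProductSpace

/-- The segment from `a` to `b` is horizontal or vertical (possibly degenerate). -/
def IsAxisParallel (a b : EuclideanSpace ℝ (Fin 2)) : Prop :=
  (∃ c : ℝ, b - a = c • (EuclideanSpace.single (0 : Fin 2) (1 : ℝ))) ∨
    (∃ c : ℝ, b - a = c • (EuclideanSpace.single (1 : Fin 2) (1 : ℝ)))

theorem IsAxisParallel.of_sub_eq_smul {a b a' b' : EuclideanSpace ℝ (Fin 2)}
    (h : IsAxisParallel a b) (t : ℝ) (ht : b' - a' = t • (b - a)) : IsAxisParallel a' b' := by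
  rcases h with ⟨c, hc⟩ | ⟨c, hc⟩
  · exact Or.inl ⟨t * c, by rw [ht, hc, smul_smul]⟩
  · exact Or.inr ⟨t * c, by rw [ht, hc, smul_smul]⟩

/-- `RectilinearArc x y S` says that `S` is the trace of a simple polygonal line from `x` to `y`
all of whose edges are axis-parallel. -/
inductive RectilinearArc (x : EuclideanSpace ℝ (Fin 2)) :
    EuclideanSpace ℝ (Fin 2) → Set (EuclideanSpace ℝ (Fin 2)) → Prop
  | refl : RectilinearArc x x {x}
  | extend {y z : EuclideanSpace ℝ (Fin 2)} {S : Set (EuclideanSpace ℝ (Fin 2))}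
      (h : RectilinearArc x y S) (hyz : IsAxisParallel y z) (hne : y ≠ z)
      (hS : S ∩ segment ℝ y z ⊆ {y}) : RectilinearArc x z (S ∪ segment ℝ y z)

namespace RectilinearArc

variable {x y z w : EuclideanSpace ℝ (Fin 2)} {S T : Set (EuclideanSpace ℝ (Fin 2))}

theorem target_mem (h : RectilinearArc x y S) : y ∈ S := by
  cases h with
  | refl => rfl
  | extend => exact Or.inr (right_mem_segment ℝ _ _)

theorem isCompact (h : RectilinearArc x y S) : IsCompact S := by
  induction h with
  | refl => exact isCompact_singleton
  | @extend y z S _ _ _ _ ih =>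
    refine ih.union ?_
    rw [segment_eq_image_lineMap]
    exact isCompact_Icc.image AffineMap.lineMap_continuous

theorem exists_truncation (h : RectilinearArc x y S) (hw : w ∈ S) :
    ∃ S' ⊆ S, RectilinearArc x w S' := by
  induction h with
  | refl => exact ⟨{x}, subset_rfl, by rw [Set.mem_singleton_iff.1 hw]; exact refl⟩
  | @extend y z S h hyz hne hS ih =>
    by_cases hwS : w ∈ S
    · obtain ⟨S', hS', h'⟩ := ih hwS
      exact ⟨S', hS'.trans Set.subset_union_left, h'⟩
    · have hw' : w ∈ segment ℝ y z := hw.resolve_left hwS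
      have hsub : segment ℝ y w ⊆ segment ℝ y z :=
        (convex_segment y z).segment_subset (left_mem_segment ℝ y z) hw'
      refine ⟨S ∪ segment ℝ y w, Set.union_subset_union_right _ hsub, h.extend ?_ ?_ ?_⟩
      · obtain ⟨t, -, rfl⟩ := (segment_eq_image_lineMap ℝ y z ▸ hw' :)
        refine hyz.of_sub_eq_smul t ?_
        simp [AffineMap.lineMap_apply]
      · rintro rfl
        exact hwS h.target_mem
      · exact (Set.inter_subset_inter_right _ hsub).trans hS

theorem exists_of_segment (h : RectilinearArc x y S) (hyz : IsAxisParallel y z) :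
    ∃ S' ⊆ S ∪ segment ℝ y z, RectilinearArc x z S' := by
  by_cases hz : z ∈ S
  · obtain ⟨S', hS', h'⟩ := h.exists_truncation hz
    exact ⟨S', hS'.trans Set.subset_union_left, h'⟩
  have hcomp : IsCompact (Set.Icc (0 : ℝ) 1 ∩ AffineMap.lineMap y z ⁻¹' S) :=
    isCompact_Icc.inter_right (h.isCompact.isClosed.preimage AffineMap.lineMap_continuous)
  obtain ⟨t, ⟨ht, htS⟩, hmax⟩ := hcomp.exists_isGreatest
    ⟨0, ⟨le_rfl, zero_le_one⟩, by simpa using h.target_mem⟩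
  set w : EuclideanSpace ℝ (Fin 2) := AffineMap.lineMap y z t with hw
  obtain ⟨S', hS', h'⟩ := h.exists_truncation htS
  have hwseg : w ∈ segment ℝ y z := by
    rw [segment_eq_image_lineMap]
    exact ⟨t, ht, rfl⟩
  have hsub : segment ℝ w z ⊆ segment ℝ y z :=
    (convex_segment y z).segment_subset hwseg (right_mem_segment ℝ y z)
  refine ⟨S' ∪ segment ℝ w z, Set.union_subset_union hS' hsub, h'.extend ?_ ?_ ?_⟩
  · refine hyz.of_sub_eq_smul (1 - t) ?_
    simp only [AffineMap.lineMap_apply, vsub_eq_sub, vadd_eq_add]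
    module
  · rintro hwz
    exact hz (hwz ▸ htS)
  · rintro u ⟨huS, hu⟩
    obtain ⟨s, hs, rfl⟩ := (segment_eq_image_lineMap ℝ w z ▸ hu :)
    have heq : AffineMap.lineMap w z s = AffineMap.lineMap y z (t + s * (1 - t)) := by
      simp only [hw, AffineMap.lineMap_apply, vsub_eq_sub, vadd_eq_add]
      module
    have hle : t + s * (1 - t) ≤ t := by
      refine hmax ⟨⟨?_, ?_⟩, ?_⟩
      · nlinarith [hs.1, hs.2, ht.1, ht.2]
      · nlinarith [hs.1, hs.2, ht.1, ht.2]
      · rw [Set.mem_preimage, ← heq]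
        exact hS' huS
    have hmul : s * (1 - t) = 0 :=
      le_antisymm (by linarith) (mul_nonneg hs.1 (by linarith [ht.2]))
    rw [Set.mem_singleton_iff, heq, hmul, add_zero]

theorem exists_of_reflTransGen (hx : x ∈ T)
    (h : Relation.ReflTransGen (fun a b ↦ IsAxisParallel a b ∧ segment ℝ a b ⊆ T) x y) :
    ∃ S ⊆ T, RectilinearArc x y S := by
  induction h with
  | refl => exact ⟨{x}, Set.singleton_subset_iff.2 hx, refl⟩
  | tail _ hbc ih =>
    obtain ⟨S, hS, h⟩ := ih
    obtain ⟨S', hS', h'⟩ := h.exists_of_segment hbc.1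
    exact ⟨S', hS'.trans (Set.union_subset hS hbc.2), h'⟩

theorem exists_eq_iUnion_segment (h : RectilinearArc x y S) :
    ∃ (n : ℕ) (a b : Fin n → EuclideanSpace ℝ (Fin 2)),
      S = ⋃ i, segment ℝ (a i) (b i) ∧ ∀ i, IsAxisParallel (a i) (b i) := by
  induction h with
  | refl => exact ⟨1, fun _ ↦ x, fun _ ↦ x, by simp, fun _ ↦ Or.inl ⟨0, by simp⟩⟩
  | @extend y z S _ hyz _ _ ih =>
    obtain ⟨n, a, b, rfl, hab⟩ := ih
    refine ⟨n + 1, Fin.cons y a, Fin.cons z b, ?_, ?_⟩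
    · ext u
      simp [Fin.exists_fin_succ, or_comm]
    · exact Fin.cases hyz hab

theorem exists_parametrization (h : RectilinearArc x y S) :
    ∃ (L : ℝ) (γ : ℝ → EuclideanSpace ℝ (Fin 2)), 0 ≤ L ∧ ContinuousOn γ (Set.Icc 0 L) ∧
      Set.InjOn γ (Set.Icc 0 L) ∧ γ '' Set.Icc 0 L = S ∧ γ 0 = x ∧ γ L = y := by
  induction h with
  | refl => exact ⟨0, fun _ ↦ x, le_rfl, continuousOn_const, by simp, by simp, rfl, rfl⟩
  | @extend y z S _ _ hne hS ih =>
    obtain ⟨L, γ, hL, hcont, hinj, himg, h0, h1⟩ := ih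
    set δ : ℝ → EuclideanSpace ℝ (Fin 2) := fun t ↦ AffineMap.lineMap y z (t - L) with hδ
    have hδL : δ L = y := by simp [hδ]
    have hδinj : Function.Injective δ := fun s t hst ↦ by
      simpa using AffineMap.lineMap_injective ℝ hne hst
    have hδimg : δ '' Set.Icc L (L + 1) = segment ℝ y z := by
      rw [segment_eq_image_lineMap, hδ, ← Set.image_image (AffineMap.lineMap y z) (· - L),
        Set.image_sub_const_Icc]
      simp
    have hunion : Set.Icc 0 L ∪ Set.Icc L (L + 1) = Set.Icc 0 (L + 1) :=
      Set.Icc_union_Icc_eq_Icc hL (by linarith)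
    set η : ℝ → EuclideanSpace ℝ (Fin 2) := fun t ↦ if t ≤ L then γ t else δ t with hη
    have hηγ : Set.EqOn η γ (Set.Icc 0 L) := fun t ht ↦ if_pos ht.2
    have hηδ : Set.EqOn η δ (Set.Icc L (L + 1)) := fun t ht ↦ by
      rcases ht.1.eq_or_lt with rfl | hlt
      · simp [hη, h1, hδL]
      · exact if_neg hlt.not_ge
    have hcross : ∀ s ∈ Set.Icc 0 L, ∀ t ∈ Set.Icc L (L + 1), η s = η t → s = t := by
      intro s hs t ht hst
      rw [hηγ hs, hηδ ht] at hst
      have hy : γ s = y := hS ⟨himg ▸ ⟨s, hs, rfl⟩, hδimg ▸ ⟨t, ht, hst.symm⟩⟩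
      rw [hinj hs ⟨hL, le_rfl⟩ (hy.trans h1.symm)]
      exact hδinj (hδL.trans (hy.symm.trans hst))
    refine ⟨L + 1, η, by linarith, ?_, ?_, ?_, ?_, ?_⟩
    · rw [← hunion]
      refine ContinuousOn.union_of_isClosed (hcont.congr hηγ) (ContinuousOn.congr ?_ hηδ)
        isClosed_Icc isClosed_Icc
      exact (AffineMap.lineMap_continuous.comp (continuous_id.sub continuous_const)).continuousOn
    · rw [← hunion]
      rintro s (hs | hs) t (ht | ht) hst
      · exact hinj hs ht (by rwa [hηγ hs, hηγ ht] at hst)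
      · exact hcross s hs t ht hst
      · exact (hcross t ht s hs hst.symm).symm
      · exact hδinj (by rwa [hηδ hs, hηδ ht] at hst)
    · rw [← hunion, Set.image_union, hηγ.image_eq, hηδ.image_eq, himg, hδimg]
    · rw [hηγ ⟨le_rfl, hL⟩, h0]
    · rw [hηδ ⟨by linarith, le_rfl⟩]
      simp [hδ]

theorem exists_unit_parametrization (h : RectilinearArc x y S) (hne : x ≠ y) :
    ∃ γ : ℝ → EuclideanSpace ℝ (Fin 2), ContinuousOn γ (Set.Icc 0 1) ∧
      Set.InjOn γ (Set.Icc 0 1) ∧ γ '' Set.Icc 0 1 = S ∧ γ 0 = x ∧ γ 1 = y := by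
  obtain ⟨L, γ, hL, hcont, hinj, himg, h0, h1⟩ := h.exists_parametrization
  have hL' : 0 < L := hL.lt_of_ne (by rintro rfl; exact hne (h0.symm.trans h1))
  have hscale : (L * ·) '' Set.Icc (0 : ℝ) 1 = Set.Icc 0 L := by
    rw [Set.image_mul_left_Icc hL zero_le_one]
    simp
  have hmaps : Set.MapsTo (L * ·) (Set.Icc (0 : ℝ) 1) (Set.Icc 0 L) :=
    hscale ▸ Set.mapsTo_image _ _
  refine ⟨γ ∘ (L * ·), hcont.comp (by fun_prop) hmaps,
    hinj.comp (mul_right_injective₀ hL'.ne').injOn hmaps, ?_, by simpa using h0, by simpa using h1⟩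
  rw [Set.image_comp, hscale, himg]

end RectilinearArc

/-- Every point of a ball is joined to the centre by an L-shaped path. -/
theorem reflTransGen_isAxisParallel_of_mem_ball {T : Set (EuclideanSpace ℝ (Fin 2))}
    {x y : EuclideanSpace ℝ (Fin 2)} {r : ℝ} (hr : Metric.ball x r ⊆ T)
    (hy : y ∈ Metric.ball x r) :
    Relation.ReflTransGen (fun a b ↦ IsAxisParallel a b ∧ segment ℝ a b ⊆ T) x y := by
  have hcorner : !₂[y 0, x 1] ∈ Metric.ball x r := by
    refine lt_of_le_of_lt ?_ (Metric.mem_ball.1 hy)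
    rw [EuclideanSpace.dist_eq, EuclideanSpace.dist_eq]
    refine Real.sqrt_le_sqrt ?_
    simp [Fin.sum_univ_two]
  have hx : x ∈ Metric.ball x r := Metric.mem_ball_self (dist_nonneg.trans_lt hy)
  have hconv := convex_ball x r
  refine Relation.ReflTransGen.tail (b := !₂[y 0, x 1]) (Relation.ReflTransGen.single ⟨?_, ?_⟩)
    ⟨?_, ?_⟩
  · refine Or.inl ⟨y 0 - x 0, ?_⟩
    ext i
    fin_cases i <;> simp
  · exact (hconv.segment_subset hx hcorner).trans hr
  · refine Or.inr ⟨y 1 - x 1, ?_⟩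
    ext i
    fin_cases i <;> simp
  · exact (hconv.segment_subset hcorner hy).trans hr

theorem symm_isAxisParallel_and_segment_subset (T : Set (EuclideanSpace ℝ (Fin 2))) :
    Std.Symm (fun a b ↦ IsAxisParallel a b ∧ segment ℝ a b ⊆ T) where
  symm a b h := ⟨h.1.of_sub_eq_smul (-1) (by simp), by rw [segment_symm]; exact h.2⟩

theorem Convex.reflTransGen_isAxisParallel {T : Set (EuclideanSpace ℝ (Fin 2))}
    (hT : Convex ℝ T) {x y : EuclideanSpace ℝ (Fin 2)}
    (hx : x ∈ interior T) (hy : y ∈ interior T) :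
    Relation.ReflTransGen (fun a b ↦ IsAxisParallel a b ∧ segment ℝ a b ⊆ T) x y := by
  refine hT.interior.isPreconnected.induction₂ _ (fun u hu ↦ ?_)
    (fun _ _ _ _ _ _ ↦ Relation.ReflTransGen.trans)
    (fun _ _ _ _ h ↦ ?_) hx hy
  · obtain ⟨r, hr, hball⟩ := Metric.isOpen_iff.1 isOpen_interior u hu
    filter_upwards [mem_nhdsWithin_of_mem_nhds (Metric.ball_mem_nhds u hr)] with v hv
    exact reflTransGen_isAxisParallel_of_mem_ball (hball.trans interior_subset) hv
  · have := symm_isAxisParallel_and_segment_subset T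
    exact symm_of (Relation.ReflTransGen _) h

/-- From a point in the relative interior of a facet one can enter the interior of a simplex
along an axis-parallel segment. -/
theorem AffineBasis.exists_isAxisParallel_mem_interior {ι : Type*} [Finite ι]
    (b : AffineBasis ι ℝ (EuclideanSpace ℝ (Fin 2))) (k : ι) {p : EuclideanSpace ℝ (Fin 2)}
    (hk : b.coord k p = 0) (hpos : ∀ i ≠ k, 0 < b.coord i p) :
    ∃ p' ∈ interior (convexHull ℝ (Set.range b)), IsAxisParallel p p' := by
  obtain ⟨j, hj⟩ : ∃ j : Fin 2, (b.coord k).linear (EuclideanSpace.single j 1) ≠ 0 := by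
    by_contra! hzero
    have hlin : (b.coord k).linear = 0 :=
      (EuclideanSpace.basisFun (Fin 2) ℝ).toBasis.ext fun j ↦ by simpa using hzero j
    have h1 := (b.coord k).linearMap_vsub (b k) p
    rw [hlin, hk] at h1
    simp at h1
  set e : EuclideanSpace ℝ (Fin 2) := EuclideanSpace.single j 1
  set c : ℝ := (b.coord k).linear e
  have hcoord : ∀ i t, b.coord i (p + t • (c • e)) =
      t * (c * (b.coord i).linear e) + b.coord i p := fun i t ↦ by
    rw [add_comm, ← vadd_eq_add, AffineMap.map_vadd]
    simp
  have hev : ∀ i, ∀ᶠ t : ℝ in nhdsWithin 0 (Set.Ioi 0), 0 < b.coord i (p + t • (c • e)) := by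
    intro i
    by_cases hi : i = k
    · subst hi
      filter_upwards [self_mem_nhdsWithin] with t ht
      rw [hcoord, hk, add_zero]
      exact mul_pos ht (mul_self_pos.2 hj)
    · refine (ContinuousAt.eventually_lt (x₀ := (0 : ℝ)) (f := fun _ ↦ (0 : ℝ))
        continuousAt_const ?_ ?_).filter_mono nhdsWithin_le_nhds
      · simp only [hcoord]
        fun_prop
      · simpa using hpos i hi
  obtain ⟨t, ht⟩ := (Filter.eventually_all.2 hev).exists
  refine ⟨p + t • (c • e), ?_, ?_⟩
  · rw [b.interior_convexHull]
    exact ht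
  · have hsub : p + t • (c • e) - p = (t * c) • e := by rw [add_sub_cancel_left, smul_smul]
    fin_cases j
    · exact Or.inl ⟨t * c, hsub⟩
    · exact Or.inr ⟨t * c, hsub⟩

theorem AffineBasis.exists_coord_eq_zero_of_mem_openSegment
    (b : AffineBasis (Fin 3) ℝ (EuclideanSpace ℝ (Fin 2))) {p : EuclideanSpace ℝ (Fin 2)}
    (hp : p ∈ openSegment ℝ (b 0) (b 1) ∪ openSegment ℝ (b 1) (b 2) ∪ openSegment ℝ (b 2) (b 0)) :
    ∃ k, b.coord k p = 0 ∧ ∀ i ≠ k, 0 < b.coord i p := by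
  rcases hp with (⟨s, t, hs, ht, hst, rfl⟩ | ⟨s, t, hs, ht, hst, rfl⟩) | ⟨s, t, hs, ht, hst, rfl⟩
  on_goal 1 => refine ⟨2, ?_, fun i hi ↦ ?_⟩
  on_goal 3 => refine ⟨0, ?_, fun i hi ↦ ?_⟩
  on_goal 5 => refine ⟨1, ?_, fun i hi ↦ ?_⟩
  all_goals rw [Convex.combo_affine_apply hst]
  all_goals try fin_cases i
  all_goals simp_all

/-- In a triangle `T` with positive area, any two distinct points `p, q` in the relative
interiors of edges of `T` can be joined by an injective path inside `T` whose image is a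
finite union of axis-parallel (horizontal or vertical) line segments. -/
theorem stmt_9 (A B C : EuclideanSpace ℝ (Fin 2)) (hABC : AffineIndependent ℝ ![A, B, C])
    (T : Set (EuclideanSpace ℝ (Fin 2))) (hT : T = convexHull ℝ {A, B, C})
    (p q : EuclideanSpace ℝ (Fin 2)) (hpq : p ≠ q)
    (hp : p ∈ openSegment ℝ A B ∪ openSegment ℝ B C ∪ openSegment ℝ C A)
    (hq : q ∈ openSegment ℝ A B ∪ openSegment ℝ B C ∪ openSegment ℝ C A) :
    ∃ γ : ℝ → EuclideanSpace ℝ (Fin 2),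
      ContinuousOn γ (Set.Icc 0 1) ∧ Set.InjOn γ (Set.Icc 0 1) ∧
      γ '' Set.Icc 0 1 ⊆ T ∧ γ 0 = p ∧ γ 1 = q ∧
      ∃ (n : ℕ) (a b : Fin n → EuclideanSpace ℝ (Fin 2)),
        γ '' Set.Icc 0 1 = ⋃ i, segment ℝ (a i) (b i) ∧
        ∀ i, (∃ c : ℝ, b i - a i = c • (EuclideanSpace.single (0 : Fin 2) (1 : ℝ))) ∨
             (∃ c : ℝ, b i - a i = c • (EuclideanSpace.single (1 : Fin 2) (1 : ℝ))) := by
  have hspan : affineSpan ℝ (Set.range ![A, B, C]) = ⊤ := by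
    rw [hABC.affineSpan_eq_top_iff_card_eq_finrank_add_one]
    simp
  let b : AffineBasis (Fin 3) ℝ (EuclideanSpace ℝ (Fin 2)) := ⟨![A, B, C], hABC, hspan⟩
  have hTb : T = convexHull ℝ (Set.range b) := by
    rw [hT]
    congr 1
    change _ = Set.range ![A, B, C]
    ext u
    simp only [Set.mem_insert_iff, Set.mem_singleton_iff, Set.mem_range, Fin.exists_fin_succ]
    simp [eq_comm]
  have hconv : Convex ℝ T := hTb ▸ convex_convexHull ℝ _
  have hmem : ∀ u, (∃ k, b.coord k u = 0 ∧ ∀ i ≠ k, 0 < b.coord i u) → u ∈ T := by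
    rintro u ⟨k, hk, hpos⟩
    rw [hTb, b.convexHull_eq_nonneg_coord]
    intro i
    by_cases hi : i = k
    · exact hi ▸ hk.ge
    · exact (hpos i hi).le
  obtain ⟨k, hk, hkpos⟩ := b.exists_coord_eq_zero_of_mem_openSegment hp
  obtain ⟨l, hl, hlpos⟩ := b.exists_coord_eq_zero_of_mem_openSegment hq
  have hpT := hmem p ⟨k, hk, hkpos⟩
  have hqT := hmem q ⟨l, hl, hlpos⟩
  obtain ⟨p', hp', hpp'⟩ := b.exists_isAxisParallel_mem_interior k hk hkpos
  obtain ⟨q', hq', hqq'⟩ := b.exists_isAxisParallel_mem_interior l hl hlpos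
  rw [← hTb] at hp' hq'
  have hchain : Relation.ReflTransGen (fun a b ↦ IsAxisParallel a b ∧ segment ℝ a b ⊆ T) p q :=
    ((hconv.reflTransGen_isAxisParallel hp' hq').head
      ⟨hpp', hconv.segment_subset hpT (interior_subset hp')⟩).tail
      ((symm_isAxisParallel_and_segment_subset T).symm _ _
        ⟨hqq', hconv.segment_subset hqT (interior_subset hq')⟩)
  obtain ⟨S, hST, hS⟩ := RectilinearArc.exists_of_reflTransGen hpT hchain
  obtain ⟨γ, hcont, hinj, rfl, h0, h1⟩ := hS.exists_unit_parametrization hpq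
  exact ⟨γ, hcont, hinj, hST, h0, h1, hS.exists_eq_iUnion_segment⟩
end

section
/- Let F be a finite family of subsets of a topological space such that every member of F has nonempty interior, and such that for any two distinct members A, B ∈ F with interior(A) ∩ interior(B) ≠ ∅, either A ⊊ B or B ⊊ A. Then every A ∈ F has at most one minimal strict superset in F: if B, C ∈ F both satisfy A ⊊ B, A ⊊ C, and there is no D ∈ F with A ⊊ D ⊊ B nor any D ∈ F with A ⊊ D ⊊ C, then B = C. -/
/-- In a finite laminar-type family of sets (members have nonempty interiors, and any two
distinct members with intersecting interiors are strictly nested), every member has at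
most one minimal strict superset. -/
theorem stmt_10 {X : Type*} [TopologicalSpace X] (F : Set (Set X)) (hF : F.Finite)
    (hne : ∀ A ∈ F, (interior A).Nonempty)
    (hlam : ∀ A ∈ F, ∀ B ∈ F, A ≠ B → (interior A ∩ interior B).Nonempty →
      A ⊂ B ∨ B ⊂ A)
    (A : Set X) (hA : A ∈ F) (B C : Set X) (hB : B ∈ F) (hC : C ∈ F)
    (hAB : A ⊂ B) (hAC : A ⊂ C)
    (hminB : ¬ ∃ D ∈ F, A ⊂ D ∧ D ⊂ B) (hminC : ¬ ∃ D ∈ F, A ⊂ D ∧ D ⊂ C) :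
    B = C := by
  by_contra hBC
  obtain ⟨x, hx⟩ := hne A hA
  have hx_mem : x ∈ interior B ∩ interior C :=
    ⟨interior_mono hAB.subset hx, interior_mono hAC.subset hx⟩
  rcases hlam B hB C hC hBC ⟨x, hx_mem⟩ with h | h
  · exact hminC ⟨B, hB, hAB, h⟩
  · exact hminB ⟨C, hC, hAC, h⟩
end

section
/- Let x₀ < x₁ be reals, let a₁ < b₁ and a₂ ≤ b₂ be reals with b₁ − a₁ ≥ b₂ − a₂, and let T ⊆ ℝ² be the trapezoid conv{(x₀,a₁), (x₀,b₁), (x₁,a₂), (x₁,b₂)}, whose longer vertical side is the segment ℓ from (x₀,a₁) to (x₀,b₁). Let W be a nonempty set of unit vectors in ℝ². Then the following are equivalent: (i) there exist finitely many reals x₀ = t₀ < t₁ < ⋯ < t_k = x₁ such that each vertical slab piece T ∩ {p : t_{i−1} ≤ p.x ≤ t_i} (for i = 1, …, k) has width at most 1 in some direction of W; (ii) there exists u ∈ W such that width_u(ℓ) < 1, or such that width_u(ℓ) = 1 and width_u(T) = 1. -/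
open scoped RealInnerProductSpace

/-- The width of a set `X ⊆ ℝ²` in direction `v`:
`width_v(X) = sup {⟪v, x - y⟫ : x, y ∈ X}`. -/
noncomputable def dwidth (v : EuclideanSpace ℝ (Fin 2)) (X : Set (EuclideanSpace ℝ (Fin 2))) : ℝ :=
  sSup {r : ℝ | ∃ x ∈ X, ∃ y ∈ X, r = ⟪v, x - y⟫}

/-- The point `(x, y)` of `ℝ²`. -/
noncomputable def pt (x y : ℝ) : EuclideanSpace ℝ (Fin 2) :=
  (WithLp.equiv 2 (Fin 2 → ℝ)).symm ![x, y]

@[simp]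
theorem pt_apply_zero (x y : ℝ) : pt x y 0 = x := rfl

@[simp]
theorem pt_apply_one (x y : ℝ) : pt x y 1 = y := rfl

theorem inner_eq_coords (u x : EuclideanSpace ℝ (Fin 2)) :
    ⟪u, x⟫ = u 0 * x 0 + u 1 * x 1 := by
  simp [PiLp.inner_apply, Fin.sum_univ_two, mul_comm]

theorem inner_sub_le_dwidth {X : Set (EuclideanSpace ℝ (Fin 2))} (hX : Bornology.IsBounded X)
    (v : EuclideanSpace ℝ (Fin 2)) {x y : EuclideanSpace ℝ (Fin 2)} (hx : x ∈ X) (hy : y ∈ X) :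
    ⟪v, x - y⟫ ≤ dwidth v X := by
  refine le_csSup ⟨‖v‖ * Metric.diam X, ?_⟩ ⟨x, hx, y, hy, rfl⟩
  rintro r ⟨p, hp, q, hq, rfl⟩
  refine (real_inner_le_norm v (p - q)).trans ?_
  rw [← dist_eq_norm]
  exact mul_le_mul_of_nonneg_left (Metric.dist_le_diam_of_mem hX hp hq) (norm_nonneg v)

theorem dwidth_le {X : Set (EuclideanSpace ℝ (Fin 2))} {v : EuclideanSpace ℝ (Fin 2)} {c : ℝ}
    (hc : 0 ≤ c) (h : ∀ x ∈ X, ∀ y ∈ X, ⟪v, x - y⟫ ≤ c) : dwidth v X ≤ c := by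
  refine Real.sSup_le ?_ hc
  rintro r ⟨p, hp, q, hq, rfl⟩
  exact h p hp q hq

theorem dwidth_nonneg (v : EuclideanSpace ℝ (Fin 2)) (X : Set (EuclideanSpace ℝ (Fin 2))) :
    0 ≤ dwidth v X := by
  rcases X.eq_empty_or_nonempty with rfl | ⟨x, hx⟩
  · simp [dwidth]
  · by_cases hb : BddAbove {r : ℝ | ∃ x ∈ X, ∃ y ∈ X, r = ⟪v, x - y⟫}
    · exact le_csSup hb ⟨x, hx, x, hx, by simp⟩
    · exact (Real.sSup_of_not_bddAbove hb).ge

theorem dwidth_mono {X Y : Set (EuclideanSpace ℝ (Fin 2))} (hY : Bornology.IsBounded Y)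
    (hXY : X ⊆ Y) (v : EuclideanSpace ℝ (Fin 2)) : dwidth v X ≤ dwidth v Y :=
  dwidth_le (dwidth_nonneg v Y) fun _ hx _ hy => inner_sub_le_dwidth hY v (hXY hx) (hXY hy)

theorem segment_pt_vertical {x a b : ℝ} (hab : a ≤ b) {p : EuclideanSpace ℝ (Fin 2)}
    (hp : p ∈ segment ℝ (pt x a) (pt x b)) : p 0 = x ∧ a ≤ p 1 ∧ p 1 ≤ b := by
  obtain ⟨α, β, hα, hβ, hαβ, rfl⟩ := hp
  obtain rfl : α = 1 - β := by linarith
  simp only [PiLp.add_apply, PiLp.smul_apply, pt_apply_zero, pt_apply_one, smul_eq_mul]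
  refine ⟨by ring, ?_, ?_⟩ <;> nlinarith

theorem isBounded_segment_pt (p q : EuclideanSpace ℝ (Fin 2)) :
    Bornology.IsBounded (segment ℝ p q) := by
  rw [← convexHull_pair, isBounded_convexHull]
  exact (Set.toFinite _).isBounded

theorem dwidth_segment_vertical (u : EuclideanSpace ℝ (Fin 2)) {x a b : ℝ} (hab : a ≤ b) :
    dwidth u (segment ℝ (pt x a) (pt x b)) = |u 1| * (b - a) := by
  apply le_antisymm
  · refine dwidth_le (mul_nonneg (abs_nonneg _) (sub_nonneg.2 hab)) fun p hp q hq => ?_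
    obtain ⟨hp0, hpa, hpb⟩ := segment_pt_vertical hab hp
    obtain ⟨hq0, hqa, hqb⟩ := segment_pt_vertical hab hq
    simp only [inner_eq_coords, PiLp.sub_apply, hp0, hq0, sub_self, mul_zero, zero_add]
    refine (le_abs_self _).trans ?_
    rw [abs_mul]
    exact mul_le_mul_of_nonneg_left (abs_le.2 ⟨by linarith, by linarith⟩) (abs_nonneg _)
  · have h₁ := inner_sub_le_dwidth (isBounded_segment_pt (pt x a) (pt x b)) u
      (right_mem_segment ℝ _ _) (left_mem_segment ℝ _ _)
    have h₂ := inner_sub_le_dwidth (isBounded_segment_pt (pt x a) (pt x b)) u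
      (left_mem_segment ℝ _ _) (right_mem_segment ℝ _ _)
    simp only [inner_eq_coords, PiLp.sub_apply, pt_apply_zero, pt_apply_one] at h₁ h₂
    rcases abs_cases (u 1) with ⟨h, _⟩ | ⟨h, _⟩ <;> rw [h] <;> linarith

/-- The trapezoid with vertical sides `{x₀} × [a₁, b₁]` and `{x₁} × [a₂, b₂]`. -/
def trapezoid (x₀ x₁ a₁ b₁ a₂ b₂ : ℝ) : Set (EuclideanSpace ℝ (Fin 2)) :=
  convexHull ℝ {pt x₀ a₁, pt x₀ b₁, pt x₁ a₂, pt x₁ b₂}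

section Trapezoid

variable {x₀ x₁ a₁ b₁ a₂ b₂ : ℝ}

theorem isBounded_trapezoid : Bornology.IsBounded (trapezoid x₀ x₁ a₁ b₁ a₂ b₂) := by
  rw [trapezoid, isBounded_convexHull]
  exact (Set.toFinite _).isBounded

theorem exists_of_mem_trapezoid (h₁ : a₁ ≤ b₁) (h₂ : a₂ ≤ b₂) {p : EuclideanSpace ℝ (Fin 2)}
    (hp : p ∈ trapezoid x₀ x₁ a₁ b₁ a₂ b₂) :
    ∃ l : ℝ, 0 ≤ l ∧ l ≤ 1 ∧ p 0 = x₀ + l * (x₁ - x₀) ∧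
      a₁ + l * (a₂ - a₁) ≤ p 1 ∧ p 1 ≤ b₁ + l * (b₂ - b₁) := by
  refine convexHull_min (t := {p : EuclideanSpace ℝ (Fin 2) | ∃ l : ℝ, 0 ≤ l ∧ l ≤ 1 ∧
    p 0 = x₀ + l * (x₁ - x₀) ∧ a₁ + l * (a₂ - a₁) ≤ p 1 ∧ p 1 ≤ b₁ + l * (b₂ - b₁)}) ?_ ?_ hp
  · rintro q (rfl | rfl | rfl | rfl)
    · exact ⟨0, by simp [h₁]⟩
    · exact ⟨0, by simp [h₁]⟩
    · exact ⟨1, by simp [h₂]⟩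
    · exact ⟨1, by simp [h₂]⟩
  · rintro p ⟨l, hl0, hl1, hp0, hpa, hpb⟩ q ⟨m, hm0, hm1, hq0, hqa, hqb⟩ α β hα hβ hαβ
    refine ⟨α * l + β * m, by positivity, by nlinarith, ?_, ?_, ?_⟩ <;>
      simp only [PiLp.add_apply, PiLp.smul_apply, smul_eq_mul]
    · rw [hp0, hq0]
      linear_combination x₀ * hαβ
    · linear_combination mul_le_mul_of_nonneg_left hpa hα +
        mul_le_mul_of_nonneg_left hqa hβ - a₁ * hαβ
    · linear_combination mul_le_mul_of_nonneg_left hpb hα +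
        mul_le_mul_of_nonneg_left hqb hβ + b₁ * hαβ

theorem segment_left_subset_trapezoid :
    segment ℝ (pt x₀ a₁) (pt x₀ b₁) ⊆ trapezoid x₀ x₁ a₁ b₁ a₂ b₂ :=
  segment_subset_convexHull (by simp) (by simp)

theorem pt_mem_trapezoid_of_bottom {l : ℝ} (h0 : 0 ≤ l) (h1 : l ≤ 1) :
    pt (x₀ + l * (x₁ - x₀)) (a₁ + l * (a₂ - a₁)) ∈ trapezoid x₀ x₁ a₁ b₁ a₂ b₂ := by
  refine segment_subset_convexHull (x := pt x₀ a₁) (y := pt x₁ a₂) (by simp) (by simp)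
    ⟨1 - l, l, by linarith, h0, by ring, ?_⟩
  ext i
  fin_cases i <;> simp <;> ring

theorem pt_mem_trapezoid_of_top {l : ℝ} (h0 : 0 ≤ l) (h1 : l ≤ 1) :
    pt (x₀ + l * (x₁ - x₀)) (b₁ + l * (b₂ - b₁)) ∈ trapezoid x₀ x₁ a₁ b₁ a₂ b₂ := by
  refine segment_subset_convexHull (x := pt x₀ b₁) (y := pt x₁ b₂) (by simp) (by simp)
    ⟨1 - l, l, by linarith, h0, by ring, ?_⟩
  ext i
  fin_cases i <;> simp <;> ring

/-- If a slab of positive thickness at the long side is no wider than that side in direction `u`,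
then neither is the whole trapezoid: both slanted edges are affine. -/
theorem dwidth_trapezoid_le (h₁ : a₁ ≤ b₁) (h₂ : a₂ ≤ b₂) {u : EuclideanSpace ℝ (Fin 2)}
    {l : ℝ} (hl0 : 0 < l) (hl1 : l ≤ 1)
    (hslab : dwidth u (trapezoid x₀ x₁ a₁ b₁ a₂ b₂ ∩
      {p | x₀ ≤ p 0 ∧ p 0 ≤ x₀ + l * (x₁ - x₀)}) ≤ |u 1| * (b₁ - a₁)) (hx : x₀ < x₁) :
    dwidth u (trapezoid x₀ x₁ a₁ b₁ a₂ b₂) ≤ |u 1| * (b₁ - a₁) := by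
  have hD : 0 ≤ l * (x₁ - x₀) := mul_nonneg hl0.le (sub_nonneg.2 hx.le)
  have hle {p q : EuclideanSpace ℝ (Fin 2)}
      (hp : p ∈ trapezoid x₀ x₁ a₁ b₁ a₂ b₂ ∩ {p | x₀ ≤ p 0 ∧ p 0 ≤ x₀ + l * (x₁ - x₀)})
      (hq : q ∈ trapezoid x₀ x₁ a₁ b₁ a₂ b₂ ∩ {p | x₀ ≤ p 0 ∧ p 0 ≤ x₀ + l * (x₁ - x₀)}) :
      u 0 * (p 0 - q 0) + u 1 * (p 1 - q 1) ≤ |u 1| * (b₁ - a₁) := by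
    have := (inner_sub_le_dwidth (isBounded_trapezoid.subset Set.inter_subset_left) u hp hq).trans
      hslab
    simpa only [inner_eq_coords, PiLp.sub_apply] using this
  have hA : pt x₀ a₁ ∈ trapezoid x₀ x₁ a₁ b₁ a₂ b₂ ∩
      {p | x₀ ≤ p 0 ∧ p 0 ≤ x₀ + l * (x₁ - x₀)} :=
    ⟨segment_left_subset_trapezoid (left_mem_segment ℝ _ _), by simp [hD]⟩
  have hB : pt x₀ b₁ ∈ trapezoid x₀ x₁ a₁ b₁ a₂ b₂ ∩
      {p | x₀ ≤ p 0 ∧ p 0 ≤ x₀ + l * (x₁ - x₀)} :=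
    ⟨segment_left_subset_trapezoid (right_mem_segment ℝ _ _), by simp [hD]⟩
  have hA' : pt (x₀ + l * (x₁ - x₀)) (a₁ + l * (a₂ - a₁)) ∈ trapezoid x₀ x₁ a₁ b₁ a₂ b₂ ∩
      {p | x₀ ≤ p 0 ∧ p 0 ≤ x₀ + l * (x₁ - x₀)} :=
    ⟨pt_mem_trapezoid_of_bottom hl0.le hl1, by simp [hD]⟩
  have hB' : pt (x₀ + l * (x₁ - x₀)) (b₁ + l * (b₂ - b₁)) ∈ trapezoid x₀ x₁ a₁ b₁ a₂ b₂ ∩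
      {p | x₀ ≤ p 0 ∧ p 0 ≤ x₀ + l * (x₁ - x₀)} :=
    ⟨pt_mem_trapezoid_of_top hl0.le hl1, by simp [hD]⟩
  refine dwidth_le (mul_nonneg (abs_nonneg _) (sub_nonneg.2 h₁)) fun p hp q hq => ?_
  obtain ⟨m, hm0, hm1, hp0, hpa, hpb⟩ := exists_of_mem_trapezoid h₁ h₂ hp
  obtain ⟨n, hn0, hn1, hq0, hqa, hqb⟩ := exists_of_mem_trapezoid h₁ h₂ hq
  simp only [inner_eq_coords, PiLp.sub_apply, hp0, hq0]
  rcases abs_cases (u 1) with ⟨h, hs⟩ | ⟨h, hs⟩ <;> rw [h] at hle ⊢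
  · have e₁ := hle hB' hA
    have e₂ := hle hB hA'
    simp only [pt_apply_zero, pt_apply_one] at e₁ e₂
    have k₁ : u 0 * (x₁ - x₀) + u 1 * (b₂ - b₁) ≤ 0 :=
      nonpos_of_mul_nonpos_right (a := l) (by linarith) hl0
    have k₂ : 0 ≤ u 0 * (x₁ - x₀) + u 1 * (a₂ - a₁) :=
      nonneg_of_mul_nonneg_right (a := l) (by linarith) hl0
    linarith [mul_le_mul_of_nonneg_left hpb hs, mul_le_mul_of_nonneg_left hqa hs,
      mul_nonneg hn0 k₂, mul_nonpos_of_nonneg_of_nonpos hm0 k₁]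
  · have e₁ := hle hA' hB
    have e₂ := hle hA hB'
    simp only [pt_apply_zero, pt_apply_one] at e₁ e₂
    have k₁ : u 0 * (x₁ - x₀) + u 1 * (a₂ - a₁) ≤ 0 :=
      nonpos_of_mul_nonpos_right (a := l) (by linarith) hl0
    have k₂ : 0 ≤ u 0 * (x₁ - x₀) + u 1 * (b₂ - b₁) :=
      nonneg_of_mul_nonneg_right (a := l) (by linarith) hl0
    linarith [mul_le_mul_of_nonpos_left hpa hs.le, mul_le_mul_of_nonpos_left hqb hs.le,
      mul_nonneg hn0 k₂, mul_nonpos_of_nonneg_of_nonpos hm0 k₁]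

theorem dwidth_slab_le (hx : x₀ < x₁) (h₁ : a₁ ≤ b₁) (h₂ : a₂ ≤ b₂)
    (hlong : b₂ - a₂ ≤ b₁ - a₁) (u : EuclideanSpace ℝ (Fin 2)) {s t ε : ℝ} (hε : 0 ≤ ε)
    (hst : t - s ≤ ε * (x₁ - x₀)) :
    dwidth u (trapezoid x₀ x₁ a₁ b₁ a₂ b₂ ∩ {p | s ≤ p 0 ∧ p 0 ≤ t}) ≤
      |u 1| * (b₁ - a₁) + ε * (|u 0| * (x₁ - x₀) + |u 1| * |a₂ - a₁|) := by
  have hD : 0 < x₁ - x₀ := sub_pos.2 hx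
  have hh : 0 ≤ b₁ - a₁ := sub_nonneg.2 h₁
  refine dwidth_le (by positivity) ?_
  rintro p ⟨hp, hps, hpt⟩ q ⟨hq, hqs, hqt⟩
  obtain ⟨m, hm0, hm1, hp0, hpa, hpb⟩ := exists_of_mem_trapezoid h₁ h₂ hp
  obtain ⟨n, hn0, hn1, hq0, hqa, hqb⟩ := exists_of_mem_trapezoid h₁ h₂ hq
  have hx' : |p 0 - q 0| ≤ ε * (x₁ - x₀) := abs_le.2 ⟨by linarith, by linarith⟩
  have hmn : |m - n| ≤ ε := by
    refine le_of_mul_le_mul_right ?_ hD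
    have hpq : p 0 - q 0 = (m - n) * (x₁ - x₀) := by
      rw [hp0, hq0]
      ring
    rwa [hpq, abs_mul, abs_of_pos hD] at hx'
  have hsl : |(m - n) * (a₂ - a₁)| ≤ ε * |a₂ - a₁| := by
    rw [abs_mul]
    exact mul_le_mul_of_nonneg_right hmn (abs_nonneg _)
  obtain ⟨hsl₁, hsl₂⟩ := abs_le.1 hsl
  have hm := mul_le_mul_of_nonneg_left hlong hm0
  have hn := mul_le_mul_of_nonneg_left hlong hn0
  have hy : |p 1 - q 1| ≤ (b₁ - a₁) + ε * |a₂ - a₁| :=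
    abs_le.2 ⟨by linarith, by linarith⟩
  rw [inner_eq_coords, PiLp.sub_apply, PiLp.sub_apply]
  have e₁ := le_abs_self (u 0 * (p 0 - q 0))
  have e₂ := le_abs_self (u 1 * (p 1 - q 1))
  rw [abs_mul] at e₁ e₂
  linarith [mul_le_mul_of_nonneg_left hx' (abs_nonneg (u 0)),
    mul_le_mul_of_nonneg_left hy (abs_nonneg (u 1))]

end Trapezoid

/-- For a trapezoid `T` with vertical parallel sides whose longer vertical side is `ℓ`,
a partition of `T` by vertical cuts into pieces each satisfying the unit-width
constraint `W` exists if and only if some `u ∈ W` satisfies `width_u(ℓ) < 1`, or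
`width_u(ℓ) = 1` and `width_u(T) = 1`. -/
theorem stmt_11 (x₀ x₁ a₁ b₁ a₂ b₂ : ℝ)
    (hx : x₀ < x₁) (h₁ : a₁ < b₁) (h₂ : a₂ ≤ b₂) (hlong : b₂ - a₂ ≤ b₁ - a₁)
    (T : Set (EuclideanSpace ℝ (Fin 2)))
    (hT : T = convexHull ℝ {pt x₀ a₁, pt x₀ b₁, pt x₁ a₂, pt x₁ b₂})
    (L : Set (EuclideanSpace ℝ (Fin 2))) (hL : L = segment ℝ (pt x₀ a₁) (pt x₀ b₁))
    (W : Set (EuclideanSpace ℝ (Fin 2))) (hWne : W.Nonempty) (hWu : ∀ v ∈ W, ‖v‖ = 1) :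
    (∃ (k : ℕ) (t : Fin (k + 1) → ℝ),
        t 0 = x₀ ∧ t (Fin.last k) = x₁ ∧ StrictMono t ∧
        ∀ i : Fin k, ∃ u ∈ W,
          dwidth u (T ∩ {p | t i.castSucc ≤ p 0 ∧ p 0 ≤ t i.succ}) ≤ 1) ↔
    (∃ u ∈ W, dwidth u L < 1 ∨ (dwidth u L = 1 ∧ dwidth u T = 1)) := by
  change T = trapezoid x₀ x₁ a₁ b₁ a₂ b₂ at hT
  subst hT hL
  have hD : 0 < x₁ - x₀ := sub_pos.2 hx
  constructor
  · rintro ⟨k, t, ht0, htk, htm, hW⟩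
    obtain _ | k := k
    · exact absurd (ht0.symm.trans htk) hx.ne
    obtain ⟨u, hu, hle⟩ := hW 0
    have ht1 : x₀ < t (Fin.succ 0) := ht0 ▸ htm (Fin.succ_pos 0)
    have ht1' : t (Fin.succ 0) ≤ x₁ := htk ▸ htm.monotone (Fin.le_last _)
    rw [Fin.castSucc_zero, ht0] at hle
    refine ⟨u, hu, ?_⟩
    have hLT := dwidth_mono isBounded_trapezoid
      (segment_left_subset_trapezoid (x₀ := x₀) (x₁ := x₁) (a₁ := a₁) (b₁ := b₁) (a₂ := a₂)
        (b₂ := b₂)) u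
    have hL1 : dwidth u (segment ℝ (pt x₀ a₁) (pt x₀ b₁)) ≤ 1 := by
      refine (dwidth_mono (isBounded_trapezoid.subset Set.inter_subset_left) ?_ u).trans hle
      intro p hp
      have hp0 := (segment_pt_vertical h₁.le hp).1
      exact ⟨segment_left_subset_trapezoid hp, hp0.ge, hp0.trans_le ht1.le⟩
    refine hL1.lt_or_eq.imp id fun hL => ⟨hL, le_antisymm ?_ (hL ▸ hLT)⟩
    rw [dwidth_segment_vertical u h₁.le] at hL
    rw [← hL] at hle ⊢
    refine dwidth_trapezoid_le h₁.le h₂ (l := (t (Fin.succ 0) - x₀) / (x₁ - x₀))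
      (div_pos (sub_pos.2 ht1) hD) ((div_le_one hD).2 (by linarith)) ?_ hx
    rwa [div_mul_cancel₀ _ hD.ne', add_sub_cancel]
  · rintro ⟨u, hu, hlt | ⟨-, hT⟩⟩
    · rw [dwidth_segment_vertical u h₁.le] at hlt
      set C := |u 0| * (x₁ - x₀) + |u 1| * |a₂ - a₁|
      obtain ⟨n, hn⟩ := exists_nat_gt (C / (1 - |u 1| * (b₁ - a₁)))
      have hn' : (0 : ℝ) < (n + 1 : ℕ) := by positivity
      refine ⟨n + 1, fun i => x₀ + (i : ℕ) * ((x₁ - x₀) / (n + 1 : ℕ)), by simp, ?_, ?_, ?_⟩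
      · simp only [Fin.val_last]
        field_simp
        ring
      · intro i j hij
        have : ((i : ℕ) : ℝ) < (j : ℕ) := by exact_mod_cast hij
        have := mul_lt_mul_of_pos_right this (div_pos hD hn')
        simpa using this
      · refine fun i => ⟨u, hu, (dwidth_slab_le hx h₁.le h₂ hlong u (ε := 1 / (n + 1 : ℕ))
          (by positivity) ?_).trans ?_⟩
        · simp only [Fin.val_succ, Fin.val_castSucc]
          apply le_of_eq
          push_cast
          ring
        · rw [div_lt_iff₀ (by linarith)] at hn
          have : 1 / ((n + 1 : ℕ) : ℝ) * C ≤ 1 - |u 1| * (b₁ - a₁) := by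
            rw [one_div_mul_eq_div, div_le_iff₀ hn']
            push_cast
            linarith
          linarith
    · refine ⟨1, ![x₀, x₁], rfl, rfl, ?_, fun i => ⟨u, hu, ?_⟩⟩
      · rw [Fin.strictMono_iff_lt_succ]
        intro i
        fin_cases i
        exact hx
      · exact (dwidth_mono isBounded_trapezoid Set.inter_subset_left u).trans hT.le
end
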